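/- Every local maximum stable set of a finite simple graph G is a subset of some maximum stable set of G. -/

import Mathlib

open Classical

variable {V : Type*} [Fintype V] [DecidableEq V]

/-- `S` is a stable (independent) set of vertices in `G`. -/
def IsStable (G : SimpleGraph V) (S : Finset V) : Prop :=
  ∀ ⦃x⦄, x ∈ S → ∀ ⦃y⦄, y ∈ S → ¬G.Adj x y

/-- The open neighborhood `N(S)`: vertices outside `S` having a neighbor in `S`. -/
noncomputable def nbhd (G : SimpleGraph V) (S : Finset V) : Finset V :=
  Finset.univ.filter fun v => v ∉ S ∧ ∃ u ∈ S, G.Adj u v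

/-- The closed neighborhood `N[S] = S ∪ N(S)`. -/
noncomputable def closedNbhd (G : SimpleGraph V) (S : Finset V) : Finset V :=
  S ∪ nbhd G S

/-- The stability (independence) number of the subgraph of `G` induced by `A`. -/
noncomputable def alphaOn (G : SimpleGraph V) (A : Finset V) : ℕ :=
  sSup {n | ∃ S ⊆ A, IsStable G S ∧ S.card = n}

/-- The stability (independence) number `α(G)`. -/
noncomputable def alpha (G : SimpleGraph V) : ℕ :=
  alphaOn G Finset.univ

/-- `S` is a maximum stable set of the subgraph of `G` induced by `N[S]`. -/
def IsLocalMaxStable (G : SimpleGraph V) (S : Finset V) : Prop :=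
  IsStable G S ∧ S.card = alphaOn G (closedNbhd G S)

/-- `Ψ(G)`: the family of all local maximum stable sets of `G`. -/
def Psi (G : SimpleGraph V) : Set (Finset V) :=
  {S | IsLocalMaxStable G S}

/-- A matching of `G`: a set of pairwise disjoint edges of `G`. -/
def IsGMatching (G : SimpleGraph V) (M : Finset (Sym2 V)) : Prop :=
  (∀ e ∈ M, e ∈ G.edgeSet) ∧
    ∀ e ∈ M, ∀ f ∈ M, e ≠ f → ∀ v : V, v ∈ e → v ∉ f

/-- A matching of `G` all of whose edges have both endpoints inside `A`,
i.e. a matching of the subgraph of `G` induced by `A`. -/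
def IsGMatchingOn (G : SimpleGraph V) (A : Finset V) (M : Finset (Sym2 V)) : Prop :=
  IsGMatching G M ∧ ∀ e ∈ M, ∀ v : V, v ∈ e → v ∈ A

/-- The matching number of the subgraph of `G` induced by `A`. -/
noncomputable def muOn (G : SimpleGraph V) (A : Finset V) : ℕ :=
  sSup {n | ∃ M, IsGMatchingOn G A M ∧ M.card = n}

/-- The matching number `μ(G)`. -/
noncomputable def mu (G : SimpleGraph V) : ℕ :=
  muOn G Finset.univ

/-- A maximum matching of `G`. -/
def IsMaximumGMatching (G : SimpleGraph V) (M : Finset (Sym2 V)) : Prop :=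
  IsGMatching G M ∧ M.card = mu G

/-- The matching `M` saturates the vertex `v`. -/
def MSaturates (M : Finset (Sym2 V)) (v : V) : Prop :=
  ∃ e ∈ M, v ∈ e

/-- A perfect matching of `G`: a matching saturating every vertex. -/
def IsPerfectGMatching (G : SimpleGraph V) (M : Finset (Sym2 V)) : Prop :=
  IsGMatching G M ∧ ∀ v : V, MSaturates M v

/-- The set of vertices saturated by `M`. -/
noncomputable def msupp (M : Finset (Sym2 V)) : Finset V :=
  Finset.univ.filter fun v => ∃ e ∈ M, v ∈ e

/-- `M` is a uniquely restricted matching: it is the unique perfect matching of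
the subgraph of `G` induced by the set of vertices saturated by `M`. -/
def UniquelyRestricted (G : SimpleGraph V) (M : Finset (Sym2 V)) : Prop :=
  IsGMatching G M ∧
    ∀ M' : Finset (Sym2 V), IsGMatchingOn G (msupp M) M' →
      (∀ v ∈ msupp M, MSaturates M' v) → M' = M

/-- Accessibility property of a set system. -/
def AccessibleFam (F : Set (Finset V)) : Prop :=
  ∀ X ∈ F, X ≠ ∅ → ∃ x ∈ X, X.erase x ∈ F

/-- Exchange property of a set system. -/
def ExchangeFam (F : Set (Finset V)) : Prop :=
  ∀ X ∈ F, ∀ Y ∈ F, X.card = Y.card + 1 → ∃ x ∈ X, x ∉ Y ∧ insert x Y ∈ F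

/-- A greedoid: a nonempty set system satisfying accessibility and exchange. -/
def IsGreedoidFam (F : Set (Finset V)) : Prop :=
  F.Nonempty ∧ AccessibleFam F ∧ ExchangeFam F

/-- A maximal stable set. -/
def IsMaximalStable (G : SimpleGraph V) (S : Finset V) : Prop :=
  IsStable G S ∧ ∀ T, IsStable G T → S ⊆ T → S = T

/-- `G` is well-covered: all maximal stable sets have the same cardinality. -/
def WellCovered (G : SimpleGraph V) : Prop :=
  ∀ S T, IsMaximalStable G S → IsMaximalStable G T → S.card = T.card

/-- `G` is very well-covered: well-covered, no isolated vertices, `|V| = 2α(G)`. -/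
def VeryWellCovered (G : SimpleGraph V) : Prop :=
  WellCovered G ∧ (∀ v : V, ∃ u, G.Adj v u) ∧ Fintype.card V = 2 * alpha G

/-- The subgraph of `G` induced by `A` is a König-Egerváry graph. -/
def KonigEgervaryOn (G : SimpleGraph V) (A : Finset V) : Prop :=
  alphaOn G A + muOn G A = A.card

/-- `G` is a König-Egerváry graph: `α(G) + μ(G) = |V(G)|`. -/
def KonigEgervary (G : SimpleGraph V) : Prop :=
  alpha G + mu G = Fintype.card V

/-- The cycle `c` is alternating with respect to `M`: of every two incident
edges of `c` exactly one belongs to `M`. -/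
def IsAlternatingCycle (G : SimpleGraph V) (M : Finset (Sym2 V)) {v : V}
    (c : G.Walk v v) : Prop :=
  c.IsCycle ∧ ∀ e ∈ c.edges, ∀ f ∈ c.edges, e ≠ f →
    (∃ u : V, u ∈ e ∧ u ∈ f) → (e ∈ M ↔ f ∉ M)

/-- `G` contains an `M`-alternating cycle. -/
def HasAlternatingCycle (G : SimpleGraph V) (M : Finset (Sym2 V)) : Prop :=
  ∃ (v : V) (c : G.Walk v v), IsAlternatingCycle G M c

/-- The cycle `c` is chordless: the subgraph induced by its vertices has no
edges other than the cycle edges. -/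
def ChordlessCycle (G : SimpleGraph V) {v : V} (c : G.Walk v v) : Prop :=
  ∀ x ∈ c.support, ∀ y ∈ c.support, G.Adj x y → s(x, y) ∈ c.edges

lemma bddAbove_card_stable (G : SimpleGraph V) (A : Finset V) :
    BddAbove {n | ∃ S ⊆ A, IsStable G S ∧ S.card = n} := by
  refine ⟨A.card, ?_⟩
  rintro n ⟨S, hSA, -, rfl⟩
  exact Finset.card_le_card hSA

lemma IsStable.card_le_alphaOn {G : SimpleGraph V} {A S : Finset V} (hS : IsStable G S)
    (hSA : S ⊆ A) : S.card ≤ alphaOn G A :=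
  le_csSup (bddAbove_card_stable G A) ⟨S, hSA, hS, rfl⟩

lemma exists_isStable_card_eq_alphaOn (G : SimpleGraph V) (A : Finset V) :
    ∃ S ⊆ A, IsStable G S ∧ S.card = alphaOn G A :=
  Nat.sSup_mem (s := {n | ∃ S ⊆ A, IsStable G S ∧ S.card = n})
    ⟨0, ∅, Finset.empty_subset A, by simp [IsStable], rfl⟩ (bddAbove_card_stable G A)

lemma IsStable.mono {G : SimpleGraph V} {S T : Finset V} (hT : IsStable G T) (hST : S ⊆ T) :
    IsStable G S :=
  fun _ hx _ hy => hT (hST hx) (hST hy)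

lemma subset_closedNbhd (G : SimpleGraph V) (S : Finset V) : S ⊆ closedNbhd G S :=
  Finset.subset_union_left

lemma not_adj_of_notMem_closedNbhd {G : SimpleGraph V} {S : Finset V} {x y : V} (hx : x ∈ S)
    (hy : y ∉ closedNbhd G S) : ¬G.Adj x y := by
  intro hxy
  simp only [closedNbhd, nbhd, Finset.mem_union, Finset.mem_filter, Finset.mem_univ, true_and,
    not_or, not_and] at hy
  exact hy.2 hy.1 ⟨x, hx, hxy⟩

lemma IsStable.union_sdiff_closedNbhd {G : SimpleGraph V} {S T : Finset V} (hS : IsStable G S)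
    (hT : IsStable G T) : IsStable G (S ∪ T \ closedNbhd G S) := by
  intro x hx y hy
  rw [Finset.mem_union, Finset.mem_sdiff] at hx hy
  rcases hx with hx | ⟨hx, hxS⟩ <;> rcases hy with hy | ⟨hy, hyS⟩
  · exact hS hx hy
  · exact not_adj_of_notMem_closedNbhd hx hyS
  · exact fun h => not_adj_of_notMem_closedNbhd hy hxS h.symm
  · exact hT hx hy

/-- Every local maximum stable set of a graph is a subset of some
maximum stable set. -/
theorem local_max_stable_subset_max_stable (G : SimpleGraph V)
    (S : Finset V) (hS : S ∈ Psi G) :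
    ∃ A : Finset V, IsStable G A ∧ A.card = alpha G ∧ S ⊆ A := by
  obtain ⟨hS, hcard⟩ := hS
  obtain ⟨T, -, hT, hTcard⟩ := exists_isStable_card_eq_alphaOn G Finset.univ
  have hA := hS.union_sdiff_closedNbhd hT
  refine ⟨_, hA, le_antisymm (hA.card_le_alphaOn (Finset.subset_univ _)) ?_,
    Finset.subset_union_left⟩
  have hle : (T ∩ closedNbhd G S).card ≤ S.card :=
    hcard ▸ (hT.mono Finset.inter_subset_left).card_le_alphaOn Finset.inter_subset_right
  have hdisj : Disjoint S (T \ closedNbhd G S) :=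
    Finset.disjoint_sdiff.mono_left (subset_closedNbhd G S)
  have hsplit := Finset.card_inter_add_card_sdiff T (closedNbhd G S)
  rw [Finset.card_union_of_disjoint hdisj, alpha, ← hTcard]
  omega
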